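/- Let μ, r̂ > 0, α ≥ 1, let L ≥ 1 be an integer, let r > 0, and let N ≥ 1 be an integer. Then the truncation error of the sum-CDF series, ε_F = (α·μ^μ/(Γ(μ)·r̂^{αμ}))^L · ∑_{i=N}^∞ δ_i · r^{αi + αμL}/Γ(αi + αμL + 1), satisfies |ε_F| < 2L · (α·μ^μ·Γ(αμ)·(r/r̂)^{αμ}/Γ(μ))^L · exp(μ·(r/r̂)^α) · γ(N, μ·(r/r̂)^α) / Γ(N), where γ(s, x) = ∫_0^x t^{s−1} e^{−t} dt is the lower incomplete gamma function. -/

import Mathlib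

open MeasureTheory Real

/-- The recursively defined coefficients δ_i. -/
noncomputable def deltaCoef (α μ rh : ℝ) (L : ℕ) : ℕ → ℝ
  | 0 => Real.Gamma (α * μ) ^ L
  | (i + 1) =>
      (1 / (((i : ℝ) + 1) * Real.Gamma (α * μ))) *
        ∑ l ∈ Finset.range (i + 1),
          deltaCoef α μ rh L (i - l) *
            ((((l : ℝ) + 1) * (L : ℝ) + ((l : ℝ) + 1) - ((i : ℝ) + 1)) *
              Real.Gamma (α * (((l : ℝ) + 1) + μ)) *
              (-μ * rh ^ (-α)) ^ (l + 1) / (Nat.factorial (l + 1) : ℝ))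
  termination_by i => i
  decreasing_by omega

/-- The lower incomplete gamma function γ(s, x) = ∫_0^x t^(s−1) e^(−t) dt. -/
noncomputable def lowerGamma (s x : ℝ) : ℝ :=
  ∫ t in (0 : ℝ)..x, t ^ (s - 1) * Real.exp (-t)

open ProbabilityTheory in
theorem integral_rpow_mul_one_sub_rpow {a b : ℝ} (ha : 0 < a) (hb : 0 < b) :
    ∫ x in Set.Ioo (0 : ℝ) 1, x ^ (a - 1) * (1 - x) ^ (b - 1) = beta a b := by
  rw [beta_eq_betaIntegralReal a b ha hb, Complex.betaIntegral,
    intervalIntegral.integral_of_le (by norm_num), ← integral_Ioc_eq_integral_Ioo,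
    ← RCLike.re_to_complex, ← integral_re]
  · refine setIntegral_congr_fun measurableSet_Ioc fun x ⟨hx₁, hx₂⟩ ↦ ?_
    norm_cast
    rw [← Complex.ofReal_cpow, ← Complex.ofReal_cpow, RCLike.re_to_complex,
      Complex.re_mul_ofReal, Complex.ofReal_re]
    all_goals linarith
  · have h := Complex.betaIntegral_convergent (u := a) (v := b) (by simpa) (by simpa)
    rwa [intervalIntegrable_iff_integrableOn_Ioc_of_le (by simp), IntegrableOn] at h

open ProbabilityTheory in
theorem integrableOn_rpow_mul_one_sub_rpow {a b : ℝ} (ha : 0 < a) (hb : 0 < b) :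
    IntegrableOn (fun x : ℝ ↦ x ^ (a - 1) * (1 - x) ^ (b - 1)) (Set.Ioo 0 1) := by
  refine Integrable.of_integral_ne_zero ?_
  rw [integral_rpow_mul_one_sub_rpow ha hb]
  exact (beta_pos ha hb).ne'

open ProbabilityTheory in
/-- The binomial sum of shifted Beta values is the integral of
`(x ^ α + (1 - x) ^ α) ^ n` against the Beta weight, and the base is at most `1`. -/
theorem sum_antidiagonal_beta_div_factorial_le {α s t : ℝ} (hα : 1 ≤ α) (hs : 0 < s)
    (ht : 0 < t) (n : ℕ) :
    ∑ p ∈ Finset.HasAntidiagonal.antidiagonal n,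
        beta (α * p.1 + s) (α * p.2 + t) / ((p.1.factorial : ℝ) * p.2.factorial) ≤
      beta s t / n.factorial := by
  have hpos (k : ℕ) {u : ℝ} (hu : 0 < u) : 0 < α * k + u := by positivity
  have hint (p : ℕ × ℕ) :=
    integrableOn_rpow_mul_one_sub_rpow (hpos p.1 hs) (hpos p.2 ht)
  simp_rw [← integral_rpow_mul_one_sub_rpow (hpos _ hs) (hpos _ ht), ← integral_div]
  rw [← integral_finsetSum _ fun p _ ↦ (hint p).div_const _,
    ← integral_rpow_mul_one_sub_rpow hs ht, ← integral_div]
  refine setIntegral_mono_on (integrable_finsetSum _ fun p _ ↦ (hint p).div_const _)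
    ((integrableOn_rpow_mul_one_sub_rpow hs ht).div_const _) measurableSet_Ioo ?_
  rintro x ⟨hx₀, hx₁⟩
  have hy : 0 < 1 - x := sub_pos.2 hx₁
  have hsum : x ^ α + (1 - x) ^ α ≤ 1 := by
    simpa using add_rpow_le_rpow_add hx₀.le hy.le hα
  have hsplit (u z : ℝ) (hz : 0 < z) (k : ℕ) :
      z ^ (α * k + u - 1) = (z ^ α) ^ k * z ^ (u - 1) := by
    rw [add_sub_assoc, rpow_add hz, rpow_mul hz.le, rpow_natCast]
  have hbinom : ∑ p ∈ Finset.HasAntidiagonal.antidiagonal n, x ^ (α * p.1 + s - 1) *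
        (1 - x) ^ (α * p.2 + t - 1) / ((p.1.factorial : ℝ) * p.2.factorial) =
      (x ^ α + (1 - x) ^ α) ^ n * (x ^ (s - 1) * (1 - x) ^ (t - 1)) / n.factorial := by
    rw [(Commute.all _ _).add_pow', Finset.sum_mul, Finset.sum_div]
    refine Finset.sum_congr rfl fun p hp ↦ ?_
    obtain rfl := Finset.HasAntidiagonal.mem_antidiagonal.1 hp
    rw [hsplit s x hx₀, hsplit t _ hy, nsmul_eq_mul, Nat.cast_add_choose]
    field_simp
  rw [hbinom]
  refine div_le_div_of_nonneg_right ?_ (by positivity)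
  exact mul_le_of_le_one_left (by positivity) (pow_le_one₀ (by positivity) hsum)

/-- The generating series of the shifted Gamma values. -/
noncomputable def gammaSeries (α t c : ℝ) : PowerSeries ℝ :=
  PowerSeries.mk fun l ↦ Gamma (α * l + t) * c ^ l / l.factorial

theorem abs_coeff_gammaSeries_pow_le {α t : ℝ} (hα : 1 ≤ α) (ht : 0 < t) (c : ℝ) (L : ℕ)
    (n : ℕ) :
    |PowerSeries.coeff n (gammaSeries α t c ^ (L + 1))| ≤
      |c| ^ n * Gamma t ^ (L + 1) / Gamma (t * (L + 1)) *
        Gamma (α * n + t * (L + 1)) / n.factorial := by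
  have hα₀ : 0 < α := by linarith
  have hΓ (k : ℕ) {u : ℝ} (hu : 0 < u) : 0 < Gamma (α * k + u) :=
    Gamma_pos_of_pos (by positivity)
  induction L generalizing n with
  | zero =>
    have h₁ := Gamma_pos_of_pos ht
    have h₂ := hΓ n ht
    simp only [gammaSeries, zero_add, pow_one, PowerSeries.coeff_mk, abs_div, abs_mul, abs_pow,
      abs_of_pos h₂, Nat.abs_cast, CharP.cast_eq_zero, mul_one]
    apply le_of_eq
    field_simp
  | succ L ih =>
    set s : ℝ := t * (L + 1) with hs_def
    have hs : 0 < s := by positivity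
    have hΓs := Gamma_pos_of_pos hs
    have hΓt := Gamma_pos_of_pos ht
    have hst : t * ((L + 1 : ℕ) + 1) = s + t := by push_cast; ring
    have hΓst := Gamma_pos_of_pos (add_pos hs ht)
    rw [hst, pow_succ, PowerSeries.coeff_mul]
    calc _ ≤ ∑ p ∈ Finset.HasAntidiagonal.antidiagonal n,
          (|c| ^ p.1 * Gamma t ^ (L + 1) / Gamma s * Gamma (α * p.1 + s) / p.1.factorial) *
            (Gamma (α * p.2 + t) * |c| ^ p.2 / p.2.factorial) := by
          refine (Finset.abs_sum_le_sum_abs _ _).trans (Finset.sum_le_sum fun p _ ↦ ?_)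
          rw [abs_mul]
          have h₂ := hΓ p.2 ht
          refine mul_le_mul (ih p.1) (le_of_eq ?_) (abs_nonneg _) ?_
          · simp only [gammaSeries, PowerSeries.coeff_mk, abs_div, abs_mul, abs_pow,
              abs_of_pos h₂, Nat.abs_cast]
          · have h₁ := hΓ p.1 hs
            positivity
      _ = |c| ^ n * Gamma t ^ (L + 1) / Gamma s * Gamma (α * n + (s + t)) *
          ∑ p ∈ Finset.HasAntidiagonal.antidiagonal n, ProbabilityTheory.beta (α * p.1 + s) (α * p.2 + t) /
            ((p.1.factorial : ℝ) * p.2.factorial) := by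
          rw [Finset.mul_sum]
          refine Finset.sum_congr rfl fun p hp ↦ ?_
          obtain rfl := Finset.HasAntidiagonal.mem_antidiagonal.1 hp
          have h₃ := hΓ (p.1 + p.2) (add_pos hs ht)
          have h₄ : α * p.1 + s + (α * p.2 + t) = α * (p.1 + p.2 : ℕ) + (s + t) := by
            push_cast; ring
          rw [ProbabilityTheory.beta, h₄, pow_add |c|]
          field_simp
      _ ≤ |c| ^ n * Gamma t ^ (L + 1) / Gamma s * Gamma (α * n + (s + t)) *
          (ProbabilityTheory.beta s t / n.factorial) := by
          have h₃ := hΓ n (add_pos hs ht)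
          gcongr
          exact sum_antidiagonal_beta_div_factorial_le hα hs ht n
      _ = _ := by
          rw [ProbabilityTheory.beta, pow_succ _ (L + 1)]
          field_simp

/-- The recursion for the coefficients of a power of a power series, obtained by comparing
coefficients in `P * (P ^ L)' = L * P' * P ^ L`. -/
theorem PowerSeries.coeff_succ_pow_mul (P : PowerSeries ℝ) (L n : ℕ) :
    (n + 1 : ℝ) * PowerSeries.coeff 0 P * PowerSeries.coeff (n + 1) (P ^ L) =
      ∑ l ∈ Finset.range (n + 1), PowerSeries.coeff (n - l) (P ^ L) *
        (((l + 1 : ℝ) * L + (l + 1) - (n + 1)) * PowerSeries.coeff (l + 1) P) := by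
  have hD : P * PowerSeries.derivative ℝ (P ^ L) =
      (L : PowerSeries ℝ) * (PowerSeries.derivative ℝ P * P ^ L) := by
    rcases L with _ | L
    · simp
    · rw [PowerSeries.derivative_pow, Nat.add_sub_cancel]
      ring
  have h := congrArg (PowerSeries.coeff n) hD
  rw [← map_natCast (PowerSeries.C (R := ℝ)), PowerSeries.coeff_C_mul, PowerSeries.coeff_mul,
    PowerSeries.coeff_mul, Finset.Nat.sum_antidiagonal_eq_sum_range_succ_mk,
    Finset.Nat.sum_antidiagonal_eq_sum_range_succ_mk, Finset.sum_range_succ'] at h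
  simp only [PowerSeries.coeff_derivative] at h
  have hlast : ∑ l ∈ Finset.range n, PowerSeries.coeff (l + 1) P *
        (PowerSeries.coeff (n - (l + 1) + 1) (P ^ L) * (((n - (l + 1) : ℕ) : ℝ) + 1)) =
      ∑ l ∈ Finset.range (n + 1), PowerSeries.coeff (l + 1) P *
        (PowerSeries.coeff (n - l) (P ^ L) * ((n : ℝ) - l)) := by
    rw [Finset.sum_range_succ, sub_self, mul_zero, mul_zero, add_zero]
    refine Finset.sum_congr rfl fun l hl ↦ ?_
    have hl' : l + 1 ≤ n := Finset.mem_range.1 hl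
    rw [show n - (l + 1) + 1 = n - l by omega, Nat.cast_sub hl']
    push_cast
    ring
  rw [hlast, Nat.sub_zero] at h
  calc _ = PowerSeries.coeff 0 P * (PowerSeries.coeff (n + 1) (P ^ L) * ((n : ℝ) + 1)) := by ring
    _ = _ := by
      rw [eq_sub_of_add_eq' h, Finset.mul_sum, ← Finset.sum_sub_distrib]
      refine Finset.sum_congr rfl fun l _ ↦ ?_
      ring

theorem deltaCoef_eq_coeff_gammaSeries_pow {α μ : ℝ} (h : 0 < α * μ) (rh : ℝ) (L n : ℕ) :
    deltaCoef α μ rh L n =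
      PowerSeries.coeff n (gammaSeries α (α * μ) (-μ * rh ^ (-α)) ^ L) := by
  induction n using Nat.strong_induction_on with
  | _ n ih =>
    rcases n with _ | n
    · simp [deltaCoef, gammaSeries]
    · have hΓ := Gamma_pos_of_pos h
      have hrec := PowerSeries.coeff_succ_pow_mul (gammaSeries α (α * μ) (-μ * rh ^ (-α))) L n
      have h₀ : PowerSeries.coeff 0 (gammaSeries α (α * μ) (-μ * rh ^ (-α))) =
          Gamma (α * μ) := by simp [gammaSeries]
      rw [h₀] at hrec
      rw [deltaCoef, one_div, inv_mul_eq_iff_eq_mul₀ (by positivity), hrec]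
      refine Finset.sum_congr rfl fun l _ ↦ ?_
      rw [ih (n - l) (by omega), gammaSeries, PowerSeries.coeff_mk, mul_add]
      push_cast
      ring

theorem one_lt_two_mul_Gamma_mul {s : ℝ} (hs : 0 < s) : 1 < 2 * Gamma s * (s + 1) := by
  rcases le_or_gt 2 s with h | h
  · have h₁ : 1 ≤ Gamma s := by
      simpa [Gamma_two] using Gamma_strictMonoOn_Ici.monotoneOn (by simp) h h
    nlinarith
  · have h₁ : 1 ≤ Gamma (s + 1 + 1) := by
      have h₂ : (2 : ℝ) ≤ s + 1 + 1 := by linarith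
      simpa [Gamma_two] using Gamma_strictMonoOn_Ici.monotoneOn (by simp) h₂ h₂
    rw [Gamma_add_one (by positivity), Gamma_add_one hs.ne'] at h₁
    have := Gamma_pos_of_pos hs
    nlinarith [mul_pos (mul_pos this (by positivity : 0 < s + 1)) (sub_pos.2 h)]

theorem lowerGamma_natCast_succ (n : ℕ) (x : ℝ) :
    lowerGamma (n + 1 : ℕ) x =
      n.factorial * (1 - exp (-x) * ∑ k ∈ Finset.range (n + 1), x ^ k / k.factorial) := by
  have hderiv (y : ℝ) : HasDerivAt
      (fun y ↦ -(n.factorial * exp (-y) * ∑ k ∈ Finset.range (n + 1), y ^ k / k.factorial))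
      (y ^ n * exp (-y)) y := by
    have hsum : ∀ m : ℕ, HasDerivAt (fun y : ℝ ↦ ∑ k ∈ Finset.range (m + 1), y ^ k / k.factorial)
        (∑ k ∈ Finset.range m, y ^ k / k.factorial) y := by
      intro m
      induction m with
      | zero => simpa using hasDerivAt_const y (1 : ℝ)
      | succ m ih =>
        simp_rw [Finset.sum_range_succ _ (m + 1)]
        rw [Finset.sum_range_succ]
        refine ih.add (((hasDerivAt_pow (m + 1) y).div_const _).congr_deriv ?_)
        rw [Nat.factorial_succ, Nat.add_sub_cancel]
        push_cast
        field_simp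
    have hexp := ((hasDerivAt_neg y).exp.const_mul (n.factorial : ℝ))
    refine (hexp.mul (hsum n)).neg.congr_deriv ?_
    rw [Finset.sum_range_succ]
    field_simp
    ring
  have hpow : ∀ t : ℝ, t ^ (((n + 1 : ℕ) : ℝ) - 1) = t ^ n := fun t ↦ by
    rw [Nat.cast_succ, add_sub_cancel_right, rpow_natCast]
  simp_rw [lowerGamma, hpow]
  rw [intervalIntegral.integral_eq_sub_of_hasDerivAt (fun y _ ↦ hderiv y)
    (Continuous.intervalIntegrable (by fun_prop) _ _)]
  have h₀ : ∑ k ∈ Finset.range (n + 1), (0 : ℝ) ^ k / k.factorial = 1 := by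
    simp [Finset.sum_range_succ']
  rw [h₀]
  simp
  ring

theorem abs_tsum_lt_of_hasSum {f g : ℕ → ℝ} {a : ℝ} (hg : HasSum g a)
    (h : ∀ i, |f i| < g i) : |∑' i, f i| < a := by
  have hf : Summable fun i ↦ ‖f i‖ :=
    hg.summable.of_nonneg_of_le (fun _ ↦ norm_nonneg _) fun i ↦ (h i).le
  rw [← hg.tsum_eq, ← norm_eq_abs]
  exact (norm_tsum_le_tsum_norm hf).trans_lt
    (Summable.tsum_lt_tsum (fun i ↦ (h i).le) (h 0) hf hg.summable)

theorem hasSum_exp_tail {N : ℕ} (hN : 1 ≤ N) (x : ℝ) :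
    HasSum (fun i : ℕ ↦ x ^ (N + i) / (N + i).factorial)
      (exp x * lowerGamma N x / Gamma N) := by
  obtain ⟨n, rfl⟩ := Nat.exists_eq_add_of_le' hN
  have h := NormedSpace.expSeries_div_hasSum_exp x
  rw [← exp_eq_exp_ℝ, ← hasSum_nat_add_iff' (n + 1)] at h
  simp_rw [add_comm (n + 1)]
  have hvalue : exp x * lowerGamma (n + 1 : ℕ) x / Gamma (n + 1 : ℕ) =
      exp x - ∑ k ∈ Finset.range (n + 1), x ^ k / k.factorial := by
    rw [lowerGamma_natCast_succ, Nat.cast_succ, Gamma_nat_eq_factorial, exp_neg]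
    field_simp
  rwa [hvalue]

theorem abs_deltaCoef_mul_rpow_div_Gamma_lt {α μ rh r : ℝ} (hμ : 0 < μ) (hrh : 0 < rh)
    (hα : 1 ≤ α) (hr : 0 < r) (K : ℕ) {n : ℕ} (hn : (1 : ℝ) ≤ n) :
    |deltaCoef α μ rh (K + 1) n * r ^ (α * n + α * μ * (K + 1)) /
        Gamma (α * n + α * μ * (K + 1) + 1)| <
      2 * (K + 1) * (Gamma (α * μ) * r ^ (α * μ)) ^ (K + 1) *
        ((μ * (r / rh) ^ α) ^ n / n.factorial) := by
  have hα₀ : 0 < α := by linarith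
  have ht : 0 < α * μ := by positivity
  set t := α * μ
  have hs : 0 < t * (K + 1) := by positivity
  have hΓt := Gamma_pos_of_pos ht
  have hΓs := Gamma_pos_of_pos hs
  set x := μ * (r / rh) ^ α with hx_def
  have hx : 0 < x := by positivity
  have hv : 0 < α * n + t * (K + 1) := by positivity
  have hΓv := Gamma_pos_of_pos hv
  have hbound := abs_coeff_gammaSeries_pow_le hα ht (-μ * rh ^ (-α)) K n
  have hc : |-μ * rh ^ (-α)| = μ * rh ^ (-α) := by
    rw [neg_mul, abs_neg, abs_of_pos (by positivity)]
  rw [← deltaCoef_eq_coeff_gammaSeries_pow ht, hc] at hbound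
  have hr_split : r ^ (α * n + t * (K + 1)) = (r ^ α) ^ n * (r ^ t) ^ (K + 1) := by
    rw [rpow_add hr, rpow_mul hr.le, rpow_mul hr.le, rpow_natCast, ← Nat.cast_succ,
      rpow_natCast]
  have hxn : x ^ n = (μ * rh ^ (-α)) ^ n * (r ^ α) ^ n := by
    rw [← mul_pow, hx_def, div_rpow hr.le hrh.le, rpow_neg hrh.le]
    ring
  rw [Gamma_add_one hv.ne', abs_div, abs_mul, abs_of_pos (rpow_pos_of_pos hr _),
    abs_of_pos (mul_pos hv hΓv), hr_split, div_lt_iff₀ (by positivity)]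
  have hlow : 1 < 2 * ((K : ℝ) + 1) * Gamma (t * (K + 1)) * (α * n + t * (K + 1)) := by
    have h₁ := one_lt_two_mul_Gamma_mul hs
    have h₂ : t * (K + 1) + 1 ≤ α * n + t * (K + 1) := by nlinarith
    have h₃ : (1 : ℝ) ≤ K + 1 := by simp
    calc 1 < 1 * (2 * Gamma (t * (K + 1)) * (t * (K + 1) + 1)) := by rwa [one_mul]
      _ ≤ (K + 1) * (2 * Gamma (t * (K + 1)) * (α * n + t * (K + 1))) := by gcongr
      _ = _ := by ring
  calc _ ≤ (μ * rh ^ (-α)) ^ n * Gamma t ^ (K + 1) / Gamma (t * (K + 1)) *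
        Gamma (α * n + t * (K + 1)) / n.factorial * ((r ^ α) ^ n * (r ^ t) ^ (K + 1)) := by
        gcongr
    _ = x ^ n * (Gamma t * r ^ t) ^ (K + 1) * Gamma (α * n + t * (K + 1)) /
        (n.factorial * Gamma (t * (K + 1))) * 1 := by
        rw [hxn, mul_pow (Gamma t)]
        field_simp
    _ < x ^ n * (Gamma t * r ^ t) ^ (K + 1) * Gamma (α * n + t * (K + 1)) /
        (n.factorial * Gamma (t * (K + 1))) *
        (2 * ((K : ℝ) + 1) * Gamma (t * (K + 1)) * (α * n + t * (K + 1))) := by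
        gcongr
    _ = _ := by
        field_simp

/-- Truncation-error bound for the sum-CDF series, case α ≥ 1. -/
theorem sum_cdf_truncation_bound_of_one_le_alpha
    (α μ rh : ℝ) (hμ : 0 < μ) (hrh : 0 < rh) (hα : 1 ≤ α)
    (L : ℕ) (hL : 1 ≤ L) (r : ℝ) (hr : 0 < r) (N : ℕ) (hN : 1 ≤ N) :
    |(α * μ ^ μ / (Real.Gamma μ * rh ^ (α * μ))) ^ L *
        ∑' i : ℕ,
          deltaCoef α μ rh L (N + i) *
            r ^ (α * ((N : ℝ) + (i : ℝ)) + α * μ * (L : ℝ)) /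
            Real.Gamma (α * ((N : ℝ) + (i : ℝ)) + α * μ * (L : ℝ) + 1)| <
      2 * (L : ℝ) *
        (α * μ ^ μ * Real.Gamma (α * μ) * (r / rh) ^ (α * μ) / Real.Gamma μ) ^ L *
        Real.exp (μ * (r / rh) ^ α) * lowerGamma (N : ℝ) (μ * (r / rh) ^ α) /
        Real.Gamma (N : ℝ) := by
  have hα₀ : 0 < α := by linarith
  obtain ⟨K, rfl⟩ := Nat.exists_eq_add_of_le' hL
  have ht : 0 < α * μ := by positivity
  set t := α * μ
  have hΓt := Gamma_pos_of_pos ht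
  have hΓμ := Gamma_pos_of_pos hμ
  set x := μ * (r / rh) ^ α
  set A := 2 * ((K + 1 : ℕ) : ℝ) * (Gamma t * r ^ t) ^ (K + 1) with hA_def
  have hterm (i : ℕ) : |deltaCoef α μ rh (K + 1) (N + i) *
        r ^ (α * ((N : ℝ) + (i : ℝ)) + t * ((K + 1 : ℕ) : ℝ)) /
        Gamma (α * ((N : ℝ) + (i : ℝ)) + t * ((K + 1 : ℕ) : ℝ) + 1)| <
      A * (x ^ (N + i) / (N + i).factorial) := by
    rw [← Nat.cast_add, hA_def, Nat.cast_succ K]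
    exact abs_deltaCoef_mul_rpow_div_Gamma_lt hμ hrh hα hr K
      (by exact_mod_cast hN.trans (Nat.le_add_right N i))
  have hsum := abs_tsum_lt_of_hasSum ((hasSum_exp_tail hN x).mul_left A) hterm
  have hB : 0 < (α * μ ^ μ / (Gamma μ * rh ^ t)) ^ (K + 1) := by positivity
  rw [abs_mul, abs_of_pos hB]
  refine (mul_lt_mul_of_pos_left hsum hB).trans_eq ?_
  have hfactor : (α * μ ^ μ * Gamma t * (r / rh) ^ t / Gamma μ) ^ (K + 1) =
      (α * μ ^ μ / (Gamma μ * rh ^ t)) ^ (K + 1) * (Gamma t * r ^ t) ^ (K + 1) := by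
    rw [← mul_pow, div_rpow hr.le hrh.le]
    congr 1
    field_simp
  rw [hfactor, hA_def]
  ring
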